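/- There are no nontrivial solutions to x^13 + y^13 = z^13 in coprime integers; i.e., if a^13 + b^13 = c^13 with gcd(a,b,c) = 1 then abc = 0. -/

import Mathlib

open NumberField Polynomial

theorem ZMod.pow_thirteen_mem (x : ZMod 53) :
    x = 0 ∨ x ^ 13 = 1 ∨ x ^ 13 = -1 ∨ x ^ 13 = 23 ∨ x ^ 13 = -23 := by
  decide +revert

theorem ZMod.eq_zero_of_pow_thirteen_add_pow_thirteen {x y z : ZMod 53}
    (h : x ^ 13 + y ^ 13 = z ^ 13) : x = 0 ∨ y = 0 ∨ z = 0 := by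
  rcases ZMod.pow_thirteen_mem x with hx | hx | hx | hx | hx
  · exact Or.inl hx
  all_goals
    rcases ZMod.pow_thirteen_mem y with hy | hy | hy | hy | hy
    · exact Or.inr (Or.inl hy)
    all_goals
      rcases ZMod.pow_thirteen_mem z with hz | hz | hz | hz | hz
      · exact Or.inr (Or.inr hz)
      all_goals
        rw [hx, hy, hz] at h
        exact absurd h (by decide)

theorem ZMod.pow_thirteen_ne_thirteen_mul {x y : ZMod 53} (hy : y ≠ 0) :
    x ^ 13 ≠ 13 * (y ^ 13) ^ 12 := by
  intro h
  rcases ZMod.pow_thirteen_mem y with hy' | hy' | hy' | hy' | hy'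
  · exact hy hy'
  all_goals
    rw [hy'] at h
    rcases ZMod.pow_thirteen_mem x with hx | hx | hx | hx | hx <;> rw [hx] at h <;>
      exact absurd h (by decide)

/-- The cofactor of `y + z` in `y ^ 13 + z ^ 13`. -/
def sumPowCofactor {R : Type*} [CommRing R] (y z : R) : R :=
  y ^ 12 - y ^ 11 * z + y ^ 10 * z ^ 2 - y ^ 9 * z ^ 3 + y ^ 8 * z ^ 4 - y ^ 7 * z ^ 5 +
    y ^ 6 * z ^ 6 - y ^ 5 * z ^ 7 + y ^ 4 * z ^ 8 - y ^ 3 * z ^ 9 + y ^ 2 * z ^ 10 -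
    y * z ^ 11 + z ^ 12

theorem add_mul_sumPowCofactor {R : Type*} [CommRing R] (y z : R) :
    (y + z) * sumPowCofactor y z = y ^ 13 + z ^ 13 := by
  unfold sumPowCofactor
  ring

theorem isCoprime_add_sumPowCofactor {x y z : ℤ} (h : x ^ 13 + y ^ 13 + z ^ 13 = 0)
    (hyz : IsCoprime y z) (hx : ¬ (13 : ℤ) ∣ x) :
    IsCoprime (y + z) (sumPowCofactor y z) := by
  have hfac := add_mul_sumPowCofactor y z
  have h13 : Prime (13 : ℤ) := by norm_num
  refine isCoprime_of_prime_dvd ?_ ?_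
  · rintro ⟨h0, -⟩
    rw [h0, zero_mul] at hfac
    have : x ^ 13 = 0 := by linarith
    exact hx (by simp [eq_zero_of_pow_eq_zero this])
  · intro q hq h1 h2
    have hmod : q ∣ 13 * y ^ 12 := by
      have hdiff : y + z ∣ sumPowCofactor y z - 13 * y ^ 12 := by
        have : sumPowCofactor y ((y + z) - y) - sumPowCofactor y (0 - y) =
          sumPowCofactor y z - 13 * y ^ 12 := by unfold sumPowCofactor; ring
        rw [← this]
        unfold sumPowCofactor
        exact ⟨z ^ 11 - 2 * z ^ 10 * y + 3 * z ^ 9 * y ^ 2 - 4 * z ^ 8 * y ^ 3 + 5 * z ^ 7 * y ^ 4 -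
          6 * z ^ 6 * y ^ 5 + 7 * z ^ 5 * y ^ 6 - 8 * z ^ 4 * y ^ 7 + 9 * z ^ 3 * y ^ 8 -
          10 * z ^ 2 * y ^ 9 + 11 * z * y ^ 10 - 12 * y ^ 11, by ring⟩
      exact (dvd_sub_right h2).mp (h1.trans hdiff)
    rcases hq.dvd_or_dvd hmod with hq13 | hqy
    · have : Associated q 13 := hq.associated_of_dvd h13 hq13
      refine hx (h13.dvd_of_dvd_pow (n := 13) ?_)
      have h3 : (13 : ℤ) ∣ y ^ 13 + z ^ 13 :=
        hfac ▸ (this.symm.dvd.trans h1).mul_right _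
      have : x ^ 13 = -(y ^ 13 + z ^ 13) := by linarith
      rw [this]
      exact h3.neg_right
    · have hy := hq.dvd_of_dvd_pow hqy
      exact hq.not_isUnit (hyz.isUnit_of_dvd' hy ((dvd_add_right hy).mp h1))

theorem exists_pow_thirteen_eq_add {x y z : ℤ} (h : x ^ 13 + y ^ 13 + z ^ 13 = 0)
    (hyz : IsCoprime y z) (hx : ¬ (13 : ℤ) ∣ x) :
    (∃ a, y + z = a ^ 13) ∧ ∃ a, sumPowCofactor y z = a ^ 13 := by
  have hco := isCoprime_add_sumPowCofactor h hyz hx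
  have hmul : (y + z) * sumPowCofactor y z = (-x) ^ 13 := by
    rw [add_mul_sumPowCofactor]
    linear_combination h
  exact ⟨Int.eq_pow_of_mul_eq_pow_odd_left hco (by decide) hmul,
    Int.eq_pow_of_mul_eq_pow_odd_right hco (by decide) hmul⟩

theorem not_fiftyThree_dvd {x y z : ℤ} (h : x ^ 13 + y ^ 13 + z ^ 13 = 0)
    (hxy : IsCoprime x y) (hyz : IsCoprime y z) (hxz : IsCoprime x z)
    (hx : ¬ (13 : ℤ) ∣ x) (hy : ¬ (13 : ℤ) ∣ y) (hz : ¬ (13 : ℤ) ∣ z) :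
    (x : ZMod 53) ≠ 0 := by
  intro hx0
  have : Fact (Nat.Prime 53) := ⟨by norm_num⟩
  obtain ⟨⟨a, ha⟩, α, hα⟩ := exists_pow_thirteen_eq_add h hyz hx
  obtain ⟨⟨b, hb⟩, -⟩ :=
    exists_pow_thirteen_eq_add (x := y) (y := x) (z := z) (by linarith) hxz hy
  obtain ⟨⟨c, hc⟩, -⟩ :=
    exists_pow_thirteen_eq_add (x := z) (y := x) (z := y) (by linarith) hxy hz
  have ha' := congrArg (Int.cast : ℤ → ZMod 53) ha
  have hb' := congrArg (Int.cast : ℤ → ZMod 53) hb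
  have hc' := congrArg (Int.cast : ℤ → ZMod 53) hc
  have hα' := congrArg (Int.cast : ℤ → ZMod 53) hα
  simp only [sumPowCofactor, Int.cast_add, Int.cast_sub, Int.cast_mul, Int.cast_pow, hx0,
    zero_add] at ha' hb' hc' hα'
  have hne {w : ℤ} (hw : IsCoprime x w) : (w : ZMod 53) ≠ 0 := by
    intro hw0
    have h53 : ((53 : ℕ) : ℤ) ∣ x := (ZMod.intCast_zmod_eq_zero_iff_dvd x 53).mp hx0
    have h53' : ((53 : ℕ) : ℤ) ∣ w := (ZMod.intCast_zmod_eq_zero_iff_dvd w 53).mp hw0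
    have := hw.isUnit_of_dvd' h53 h53'
    rw [Int.isUnit_iff] at this
    omega
  have hb0 : (b : ZMod 53) ≠ 0 := by
    rintro h0
    exact hne hxz (by rw [hb', h0, zero_pow (by norm_num)])
  have hc0 : (c : ZMod 53) ≠ 0 := by
    rintro h0
    exact hne hxy (by rw [hc', h0, zero_pow (by norm_num)])
  have ha0 : (a : ZMod 53) = 0 := by
    rcases ZMod.eq_zero_of_pow_thirteen_add_pow_thirteen
      (x := (c : ZMod 53)) (y := b) (z := a) (by rw [← ha', ← hb', ← hc']) with h0 | h0 | h0
    · exact absurd h0 hc0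
    · exact absurd h0 hb0
    · exact h0
  have hzy : (z : ZMod 53) = -y := by
    rw [ha0, zero_pow (by norm_num)] at ha'
    linear_combination ha'
  refine ZMod.pow_thirteen_ne_thirteen_mul (x := (α : ZMod 53)) hc0 ?_
  rw [← hc', ← hα', hzy]
  ring

/-- The first case of Fermat's Last Theorem for exponent `13`, by Sophie Germain's method with
auxiliary prime `53`. -/
theorem fermat_thirteen_first_case {x y z : ℤ} (h : x ^ 13 + y ^ 13 + z ^ 13 = 0)
    (hxy : IsCoprime x y) (hyz : IsCoprime y z) (hxz : IsCoprime x z)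
    (hx : ¬ (13 : ℤ) ∣ x) (hy : ¬ (13 : ℤ) ∣ y) (hz : ¬ (13 : ℤ) ∣ z) : False := by
  have hmod := congrArg (Int.cast : ℤ → ZMod 53) h
  push_cast at hmod
  rcases ZMod.eq_zero_of_pow_thirteen_add_pow_thirteen
    (x := (x : ZMod 53)) (y := y) (z := -z)
    (by rw [Odd.neg_pow (by decide)]; linear_combination hmod) with h0 | h0 | h0
  · exact not_fiftyThree_dvd h hxy hyz hxz hx hy hz h0
  · exact not_fiftyThree_dvd (x := y) (y := x) (z := z) (by linarith) hxy.symm hxz hyz hy hx hz h0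
  · exact not_fiftyThree_dvd (x := z) (y := x) (z := y) (by linarith) hxz.symm hxy hyz.symm
      hz hx hy (neg_eq_zero.mp h0)

section CyclotomicThirteen

instance fact_prime_thirteen : Fact (Nat.Prime 13) := ⟨by norm_num⟩

/-- `h` is the logarithmic derivative of `f` with respect to `(X + 1) d/dX`, modulo `X ^ 11`. -/
def IsLogDeriv (f h : (ZMod 13)[X]) : Prop :=
  f.coeff 0 ≠ 0 ∧ X ^ 11 ∣ (X + 1) * derivative f - f * h

theorem isLogDeriv_one : IsLogDeriv 1 0 := by simp [IsLogDeriv]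

theorem IsLogDeriv.mul {f g h k : (ZMod 13)[X]} (hf : IsLogDeriv f h) (hg : IsLogDeriv g k) :
    IsLogDeriv (f * g) (h + k) := by
  refine ⟨by simpa [mul_coeff_zero] using ⟨hf.1, hg.1⟩, ?_⟩
  convert dvd_add (hf.2.mul_left g) (hg.2.mul_left f) using 1
  rw [derivative_mul]
  ring

theorem IsLogDeriv.pow {f h : (ZMod 13)[X]} (hf : IsLogDeriv f h) (n : ℕ) :
    IsLogDeriv (f ^ n) (n * h) := by
  induction n with
  | zero => simpa using isLogDeriv_one
  | succ n ih => simpa [pow_succ, add_mul] using ih.mul hf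

theorem IsLogDeriv.dvd_of_dvd_sub_C {f h : (ZMod 13)[X]} (hf : IsLogDeriv f h) {n : ZMod 13}
    (hn : X ^ 12 ∣ f - C n) : X ^ 11 ∣ h := by
  have hderiv : X ^ 11 ∣ derivative f := by
    obtain ⟨q, hq⟩ := hn
    have h := congrArg derivative hq
    rw [derivative_sub, derivative_C, sub_zero, derivative_mul, derivative_X_pow] at h
    exact h ▸ ⟨C 12 * q + X * derivative q, by push_cast; ring⟩
  refine prime_X.pow_dvd_of_dvd_mul_left 11 (fun h0 ↦ hf.1 (X_dvd_iff.mp h0)) ?_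
  exact (dvd_sub_right (hderiv.mul_left _)).mp hf.2

theorem thirteen_eq_zero : (13 : (ZMod 13)[X]) = 0 := by
  exact_mod_cast CharP.cast_eq_zero (ZMod 13)[X] 13

theorem isLogDeriv_geom_two : IsLogDeriv (2 + X)
    (-6 - 3 * X - 5 * X ^ 2 - 4 * X ^ 3 + 2 * X ^ 4 - X ^ 5 - 6 * X ^ 6 + 3 * X ^ 7 +
      5 * X ^ 8 + 4 * X ^ 9 - 2 * X ^ 10) := by
  refine ⟨by simp; decide, 2, ?_⟩
  have hd : derivative (2 + X : (ZMod 13)[X]) = 1 := by simp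
  rw [hd]
  linear_combination (1 + X + X ^ 2 + X ^ 3 + X ^ 6 - X ^ 8 - X ^ 9) * thirteen_eq_zero

theorem isLogDeriv_geom_three : IsLogDeriv (3 + 3 * X + X ^ 2)
    (1 + 5 * X + 4 * X ^ 2 + 3 * X ^ 3 - X ^ 5 + X ^ 6 - 5 * X ^ 7 - 4 * X ^ 8 -
      3 * X ^ 9) := by
  refine ⟨by simp; decide, 3, ?_⟩
  have hd : derivative (3 + 3 * X + X ^ 2 : (ZMod 13)[X]) = 3 + 2 * X := by
    simp only [derivative_add, derivative_mul, derivative_X, derivative_X_pow, derivative_ofNat,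
      map_natCast]
    push_cast
    ring
  rw [hd]
  linear_combination (-X - 2 * X ^ 2 - 2 * X ^ 3 - X ^ 4 + X ^ 7 + 2 * X ^ 8 + 2 * X ^ 9 +
    X ^ 10) * thirteen_eq_zero

theorem isLogDeriv_geom_four : IsLogDeriv (4 + 6 * X + 4 * X ^ 2 + X ^ 3)
    (-5 - 2 * X + X ^ 2 - 4 * X ^ 3 - X ^ 4 + 2 * X ^ 5 - X ^ 6 + 3 * X ^ 7 - 4 * X ^ 8) := by
  refine ⟨by simp; decide, 4, ?_⟩
  have hd : derivative (4 + 6 * X + 4 * X ^ 2 + X ^ 3 : (ZMod 13)[X]) =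
      6 + 8 * X + 3 * X ^ 2 := by
    simp only [derivative_add, derivative_mul, derivative_X, derivative_X_pow, derivative_ofNat,
      map_natCast]
    push_cast
    ring
  rw [hd]
  linear_combination (2 + 4 * X + 3 * X ^ 2 + 2 * X ^ 3 + 2 * X ^ 4 + X ^ 5 - X ^ 7 + X ^ 9 +
    X ^ 10) * thirteen_eq_zero

theorem isLogDeriv_geom_five : IsLogDeriv (5 + 10 * X + 10 * X ^ 2 + 5 * X ^ 3 + X ^ 4)
    (2 + 2 * X - X ^ 2 + 5 * X ^ 3 + 6 * X ^ 4 + 2 * X ^ 5 + 2 * X ^ 7 - 2 * X ^ 8 -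
      3 * X ^ 9 - 5 * X ^ 10) := by
  refine ⟨by simp; decide, 88 + 67 * X + 28 * X ^ 2 + 5 * X ^ 3, ?_⟩
  have hd : derivative (5 + 10 * X + 10 * X ^ 2 + 5 * X ^ 3 + X ^ 4 : (ZMod 13)[X]) =
      10 + 20 * X + 15 * X ^ 2 + 4 * X ^ 3 := by
    simp only [derivative_add, derivative_mul, derivative_X, derivative_X_pow, derivative_ofNat,
      map_natCast]
    push_cast
    ring
  rw [hd]
  linear_combination (-2 * X ^ 3 - 6 * X ^ 4 - 9 * X ^ 5 - 8 * X ^ 6 - 5 * X ^ 7 - 2 * X ^ 8 +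
    X ^ 9 + 5 * X ^ 10) * thirteen_eq_zero

theorem isLogDeriv_geom_six :
    IsLogDeriv (6 + 15 * X + 20 * X ^ 2 + 15 * X ^ 3 + 6 * X ^ 4 + X ^ 5)
      (-4 + 4 * X - 2 * X ^ 2 - 2 * X ^ 3 + 4 * X ^ 4 - 3 * X ^ 5 - 6 * X ^ 6) := by
  refine ⟨by simp; decide, 6, ?_⟩
  have hd : derivative (6 + 15 * X + 20 * X ^ 2 + 15 * X ^ 3 + 6 * X ^ 4 + X ^ 5 :
      (ZMod 13)[X]) = 15 + 40 * X + 45 * X ^ 2 + 24 * X ^ 3 + 5 * X ^ 4 := by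
    simp only [derivative_add, derivative_mul, derivative_X, derivative_X_pow, derivative_ofNat,
      map_natCast]
    push_cast
    ring
  rw [hd]
  linear_combination (3 + 7 * X + 9 * X ^ 2 + 7 * X ^ 3 + 3 * X ^ 4 + X ^ 5 + 3 * X ^ 6 +
    8 * X ^ 7 + 11 * X ^ 8 + 8 * X ^ 9 + 3 * X ^ 10) * thirteen_eq_zero

theorem eq_zero_of_linear_system {a b c d e f : ZMod 13}
    (h₀ : a - 6 * b + c - 5 * d + 2 * e - 4 * f = 0)
    (h₁ : -3 * b + 5 * c - 2 * d + 2 * e + 4 * f = 0)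
    (h₃ : -4 * b + 3 * c - 4 * d + 5 * e - 2 * f = 0)
    (h₅ : -b - c + 2 * d + 2 * e - 3 * f = 0)
    (h₇ : 3 * b - 5 * c + 3 * d + 2 * e = 0)
    (h₉ : 4 * b - 3 * c - 3 * e = 0) :
    a = 0 ∧ b = 0 ∧ c = 0 ∧ d = 0 ∧ e = 0 ∧ f = 0 := by
  refine ⟨?_, ?_, ?_, ?_, ?_, ?_⟩
  · linear_combination (norm := (ring_nf; reduce_mod_char))
      h₀ - 3 * h₁ - 4 * h₃ + 6 * h₅ - h₇ + 4 * h₉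
  · linear_combination (norm := (ring_nf; reduce_mod_char))
      -6 * h₁ + 6 * h₃ + h₅ - h₇ + 6 * h₉
  · linear_combination (norm := (ring_nf; reduce_mod_char))
      6 * h₁ + h₃ + 3 * h₅ - h₇ - 6 * h₉
  · linear_combination (norm := (ring_nf; reduce_mod_char))
      -5 * h₁ + 4 * h₃ - 5 * h₅ - 3 * h₇ - 2 * h₉
  · linear_combination (norm := (ring_nf; reduce_mod_char))
      -h₁ - 6 * h₃ - 6 * h₅ + 4 * h₇ + 5 * h₉
  · linear_combination (norm := (ring_nf; reduce_mod_char))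
      -4 * h₁ + 5 * h₃ + 4 * h₅ - 3 * h₇ + 2 * h₉

theorem natCast_eq_zero_of_X_pow_dvd {i d₂ d₃ d₄ d₅ d₆ : ℕ} {n : ZMod 13}
    (h : X ^ 12 ∣ (X + 1) ^ i * (2 + X) ^ d₂ * (3 + 3 * X + X ^ 2) ^ d₃ *
      (4 + 6 * X + 4 * X ^ 2 + X ^ 3) ^ d₄ *
      (5 + 10 * X + 10 * X ^ 2 + 5 * X ^ 3 + X ^ 4) ^ d₅ *
      (6 + 15 * X + 20 * X ^ 2 + 15 * X ^ 3 + 6 * X ^ 4 + X ^ 5) ^ d₆ - C n) :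
    (i : ZMod 13) = 0 ∧ (d₂ : ZMod 13) = 0 ∧ (d₃ : ZMod 13) = 0 ∧ (d₄ : ZMod 13) = 0 ∧
      (d₅ : ZMod 13) = 0 ∧ (d₆ : ZMod 13) = 0 := by
  have hX : IsLogDeriv (X + 1) 1 := by simp [IsLogDeriv]
  have key := ((((((hX.pow i).mul (isLogDeriv_geom_two.pow d₂)).mul
    (isLogDeriv_geom_three.pow d₃)).mul (isLogDeriv_geom_four.pow d₄)).mul
    (isLogDeriv_geom_five.pow d₅)).mul (isLogDeriv_geom_six.pow d₆)).dvd_of_dvd_sub_C h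
  rw [X_pow_dvd_iff] at key
  have h₀ := key 0 (by norm_num)
  have h₁ := key 1 (by norm_num)
  have h₃ := key 3 (by norm_num)
  have h₅ := key 5 (by norm_num)
  have h₇ := key 7 (by norm_num)
  have h₉ := key 9 (by norm_num)
  simp [coeff_X, coeff_X_pow, coeff_one, coeff_natCast_mul, coeff_ofNat_mul] at h₀ h₁ h₃ h₅ h₇ h₉
  refine eq_zero_of_linear_system ?_ ?_ ?_ ?_ ?_ ?_
  · linear_combination h₀
  · linear_combination h₁
  · linear_combination h₃
  · linear_combination h₅
  · linear_combination h₇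
  · linear_combination h₉

variable {K : Type*} [Field K] {ζ : K} (hζ : IsPrimitiveRoot ζ 13)

theorem minpoly_toInteger [NumberField K] : minpoly ℤ hζ.toInteger = cyclotomic 13 ℤ := by
  rw [cyclotomic_eq_minpoly hζ (by norm_num)]
  exact (minpoly.algebraMap_eq (RingOfIntegers.coe_injective) hζ.toInteger).symm

theorem sum_pow_toInteger_eq_zero :
    1 + hζ.toInteger + hζ.toInteger ^ 2 + hζ.toInteger ^ 3 + hζ.toInteger ^ 4 +
      hζ.toInteger ^ 5 + hζ.toInteger ^ 6 + hζ.toInteger ^ 7 + hζ.toInteger ^ 8 +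
      hζ.toInteger ^ 9 + hζ.toInteger ^ 10 + hζ.toInteger ^ 11 + hζ.toInteger ^ 12 = 0 := by
  have h := hζ.toInteger_isPrimitiveRoot.geom_sum_eq_zero (by norm_num)
  simpa [Finset.sum_range_succ] using h

variable [NumberField K] [IsCyclotomicExtension {13} ℚ K]

theorem exists_aeval_toInteger_eq (x : 𝓞 K) : ∃ f : ℤ[X], aeval hζ.toInteger f = x := by
  have h : x ∈ Algebra.adjoin ℤ {hζ.toInteger} := by
    rw [IsCyclotomicExtension.Rat.adjoin_singleton_eq_top hζ]
    trivial
  rwa [Algebra.adjoin_singleton_eq_range_aeval] at h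

/-- Modulo any divisor of `ζ - g`, every integer of the cyclotomic field is rational. -/
theorem exists_int_dvd_sub {α : 𝓞 K} {g : ℤ} (hg : α ∣ hζ.toInteger - g) (x : 𝓞 K) :
    ∃ n : ℤ, α ∣ x - n := by
  obtain ⟨f, rfl⟩ := exists_aeval_toInteger_eq hζ x
  refine ⟨f.eval g, hg.trans ?_⟩
  have h := sub_dvd_eval_sub hζ.toInteger (g : 𝓞 K) (f.map (algebraMap ℤ (𝓞 K)))
  rw [eval_map_algebraMap, eval_map_algebraMap] at h
  convert h using 2
  rw [← eq_intCast (algebraMap ℤ (𝓞 K)) g, aeval_algebraMap_apply]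
  simp

theorem exists_isPrincipal_mem_primesOver {p : ℕ} (hp : p.Prime) {g : ℤ}
    (hg : (cyclotomic 13 ℤ).aeval (g : ZMod p) = 0) (f : ℤ[X])
    (hf : f.aeval (g : ZMod p) = 0) (hdvd : aeval hζ.toInteger f ∣ (p : 𝓞 K))
    (hdvd' : aeval hζ.toInteger f ∣ hζ.toInteger - g) :
    ∃ P ∈ Ideal.primesOver (Ideal.span {(p : ℤ)}) (𝓞 K), Submodule.IsPrincipal P := by
  have : Fact p.Prime := ⟨hp⟩
  let pb := hζ.integralPowerBasis
  have hgen : pb.gen = hζ.toInteger := hζ.integralPowerBasis_gen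
  let φ : 𝓞 K →ₐ[ℤ] ZMod p := pb.lift (g : ZMod p) (by rw [hgen, minpoly_toInteger, hg])
  have hφ (q : ℤ[X]) : φ (aeval hζ.toInteger q) = q.aeval (g : ZMod p) := by
    rw [← hgen]
    exact pb.lift_aeval _ _ _
  have hker : RingHom.ker φ = Ideal.span {aeval hζ.toInteger f} := by
    refine le_antisymm (fun x hx ↦ ?_) ?_
    · rw [Ideal.mem_span_singleton]
      obtain ⟨n, hn⟩ := exists_int_dvd_sub hζ hdvd' x
      have hφn : φ (x - n) = 0 := by
        obtain ⟨y, hy⟩ := hn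
        rw [hy, map_mul, hφ, hf, zero_mul]
      rw [map_sub, (RingHom.mem_ker).mp hx, zero_sub, neg_eq_zero, map_intCast,
        ZMod.intCast_zmod_eq_zero_iff_dvd] at hφn
      refine (dvd_sub_left (hdvd.trans ?_)).mp hn
      simpa using Int.cast_dvd_cast (α := 𝓞 K) _ _ hφn
    · rw [Ideal.span_singleton_le_iff_mem, RingHom.mem_ker, hφ, hf]
  refine ⟨RingHom.ker φ, ⟨RingHom.ker_isPrime _, ⟨?_⟩⟩, ⟨_, hker⟩⟩
  ext n
  simp [Ideal.mem_span_singleton, ← ZMod.intCast_zmod_eq_zero_iff_dvd]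

theorem dvd_certificate_fiftyThree {R : Type*} [CommRing R] {z : R}
    (h : 1 + z + z ^ 2 + z ^ 3 + z ^ 4 + z ^ 5 + z ^ 6 + z ^ 7 + z ^ 8 + z ^ 9 + z ^ 10 +
      z ^ 11 + z ^ 12 = 0) :
    1 + z + z ^ 3 ∣ 53 ∧ 1 + z + z ^ 3 ∣ z - 36 :=
  ⟨⟨1 - 24 * z - 35 * z ^ 2 - 25 * z ^ 3 - 10 * z ^ 4 - 14 * z ^ 5 - 20 * z ^ 6 - 29 * z ^ 7 -
      16 * z ^ 8 - 23 * z ^ 9 - 7 * z ^ 10 - 36 * z ^ 11,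
      by linear_combination -(-52 + 29 * z - 36 * z ^ 2) * h⟩,
    ⟨17 * z + 24 * z ^ 2 + 17 * z ^ 3 + 7 * z ^ 4 + 10 * z ^ 5 + 14 * z ^ 6 + 20 * z ^ 7 +
      11 * z ^ 8 + 16 * z ^ 9 + 5 * z ^ 10 + 25 * z ^ 11,
      by linear_combination -(36 - 20 * z + 25 * z ^ 2) * h⟩⟩

theorem dvd_certificate_oneHundredThirtyOne {R : Type*} [CommRing R] {z : R}
    (h : 1 + z + z ^ 2 + z ^ 3 + z ^ 4 + z ^ 5 + z ^ 6 + z ^ 7 + z ^ 8 + z ^ 9 + z ^ 10 +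
      z ^ 11 + z ^ 12 = 0) :
    1 - z - z ^ 3 ∣ 131 ∧ 1 - z - z ^ 3 ∣ z - 80 :=
  ⟨⟨111 + 78 * z + 17 * z ^ 2 + 67 * z ^ 3 + 84 * z ^ 4 + 40 * z ^ 5 + 46 * z ^ 6 + 69 * z ^ 7 +
      48 * z ^ 8 + 33 * z ^ 9 + 41 * z ^ 10 + 28 * z ^ 11,
      by linear_combination -(-20 - 13 * z - 28 * z ^ 2) * h⟩,
    ⟨-68 - 47 * z - 10 * z ^ 2 - 41 * z ^ 3 - 51 * z ^ 4 - 24 * z ^ 5 - 28 * z ^ 6 - 42 * z ^ 7 -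
      29 * z ^ 8 - 20 * z ^ 9 - 25 * z ^ 10 - 17 * z ^ 11,
      by linear_combination -(12 + 8 * z + 17 * z ^ 2) * h⟩⟩

theorem dvd_certificate_seventyNine {R : Type*} [CommRing R] {z : R}
    (h : 1 + z + z ^ 2 + z ^ 3 + z ^ 4 + z ^ 5 + z ^ 6 + z ^ 7 + z ^ 8 + z ^ 9 + z ^ 10 +
      z ^ 11 + z ^ 12 = 0) :
    1 + z - z ^ 4 ∣ 79 ∧ 1 + z - z ^ 4 ∣ z - 64 :=
  ⟨⟨24 - 25 * z - 27 * z ^ 2 + 10 * z ^ 3 - 3 * z ^ 4 - 39 * z ^ 5 - 5 * z ^ 6 - 2 * z ^ 7 -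
      18 * z ^ 8 - 38 * z ^ 9 + 16 * z ^ 10 - 35 * z ^ 11,
      by linear_combination -(-55 + 54 * z - 51 * z ^ 2 + 35 * z ^ 3) * h⟩,
    ⟨-19 + 21 * z + 22 * z ^ 2 - 8 * z ^ 3 + 3 * z ^ 4 + 32 * z ^ 5 + 4 * z ^ 6 + 2 * z ^ 7 +
      15 * z ^ 8 + 31 * z ^ 9 - 13 * z ^ 10 + 29 * z ^ 11,
      by linear_combination -(45 - 44 * z + 42 * z ^ 2 - 29 * z ^ 3) * h⟩⟩

theorem dvd_certificate_oneHundredFiftySeven {R : Type*} [CommRing R] {z : R}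
    (h : 1 + z + z ^ 2 + z ^ 3 + z ^ 4 + z ^ 5 + z ^ 6 + z ^ 7 + z ^ 8 + z ^ 9 + z ^ 10 +
      z ^ 11 + z ^ 12 = 0) :
    1 - z + z ^ 2 + z ^ 4 ∣ 157 ∧ 1 - z + z ^ 2 + z ^ 4 ∣ z - 75 :=
  ⟨⟨89 + 86 * z + 42 * z ^ 2 + 77 * z ^ 3 + 67 * z ^ 4 + 25 * z ^ 5 + 37 * z ^ 6 + 56 * z ^ 7 +
      73 * z ^ 8 + 113 * z ^ 9 + 124 * z ^ 10 + 76 * z ^ 11,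
      by linear_combination -(-68 + 65 * z + 48 * z ^ 2 + 76 * z ^ 3) * h⟩,
    ⟨-43 - 41 * z - 20 * z ^ 2 - 37 * z ^ 3 - 32 * z ^ 4 - 12 * z ^ 5 - 18 * z ^ 6 - 27 * z ^ 7 -
      35 * z ^ 8 - 54 * z ^ 9 - 59 * z ^ 10 - 36 * z ^ 11,
      by linear_combination -(32 - 31 * z - 23 * z ^ 2 - 36 * z ^ 3) * h⟩⟩

/-- The four cubic Gaussian periods for `13` have product `3`. -/
theorem prod_gaussian_periods {R : Type*} [CommRing R] {z : R}
    (h : 1 + z + z ^ 2 + z ^ 3 + z ^ 4 + z ^ 5 + z ^ 6 + z ^ 7 + z ^ 8 + z ^ 9 + z ^ 10 +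
      z ^ 11 + z ^ 12 = 0) :
    (z + z ^ 3 + z ^ 9) * (z ^ 2 + z ^ 6 + z ^ 5) * (z ^ 4 + z ^ 12 + z ^ 10) *
      (z ^ 8 + z ^ 11 + z ^ 7) = 3 := by
  linear_combination (-3 + 3 * z - 3 * z ^ 13 + 4 * z ^ 14 + z ^ 17 + z ^ 18 - z ^ 19 +
    2 * z ^ 20 - z ^ 21 + z ^ 22 + z ^ 23 + z ^ 26) * h

theorem norm_gaussian_period (k : ℕ) (hk : k.Coprime 13) :
    Algebra.norm ℤ (hζ.toInteger ^ k + hζ.toInteger ^ (3 * k) + hζ.toInteger ^ (9 * k)) =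
      Algebra.norm ℤ (hζ.toInteger + hζ.toInteger ^ 3 + hζ.toInteger ^ 9) := by
  let σ : Gal(K/ℚ) :=
    (IsCyclotomicExtension.Rat.galEquivZMod 13 K).symm (ZMod.unitOfCoprime k hk)
  have hz13 := hζ.toInteger_isPrimitiveRoot.pow_eq_one
  have hσ : σ • hζ.toInteger = hζ.toInteger ^ k := by
    rw [IsCyclotomicExtension.Rat.galEquivZMod_smul_of_pow_eq 13 K σ hz13]
    simp only [σ, MulEquiv.apply_symm_apply, ZMod.coe_unitOfCoprime, ZMod.val_natCast]
    exact (pow_mod_orderOf hζ.toInteger k ▸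
      hζ.toInteger_isPrimitiveRoot.eq_orderOf ▸ rfl)
  rw [← Algebra.norm_eq_of_algEquiv (MulSemiringAction.toAlgEquiv ℤ (𝓞 K) σ)
    (hζ.toInteger + hζ.toInteger ^ 3 + hζ.toInteger ^ 9)]
  simp only [map_add, map_pow, MulSemiringAction.toAlgEquiv_apply, hσ, ← pow_mul, mul_comm k]

theorem absNorm_span_gaussian_period (k : ℕ) (hk : k.Coprime 13) :
    Ideal.absNorm (Ideal.span {hζ.toInteger ^ k + hζ.toInteger ^ (3 * k) +
      hζ.toInteger ^ (9 * k)}) = 27 := by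
  have hprod := congrArg (Algebra.norm ℤ) (prod_gaussian_periods (sum_pow_toInteger_eq_zero hζ))
  have h2 := norm_gaussian_period hζ 2 (by norm_num)
  have h4 := norm_gaussian_period hζ 4 (by norm_num)
  have h8 := norm_gaussian_period hζ 8 (by norm_num)
  have hpow (i j : ℕ) : hζ.toInteger ^ (13 * i + j) = hζ.toInteger ^ j := by
    rw [pow_add, pow_mul, hζ.toInteger_isPrimitiveRoot.pow_eq_one, one_pow, one_mul]
  rw [show 9 * 2 = 13 * 1 + 5 by norm_num, hpow] at h2
  rw [show 9 * 4 = 13 * 2 + 10 by norm_num, hpow] at h4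
  rw [show 3 * 8 = 13 * 1 + 11 by norm_num, show 9 * 8 = 13 * 5 + 7 by norm_num, hpow, hpow] at h8
  have hfin : Module.finrank ℤ (𝓞 K) = 12 := by
    rw [RingOfIntegers.rank, IsCyclotomicExtension.Rat.finrank 13 K]
    decide
  have h3 : Algebra.norm ℤ (3 : 𝓞 K) = 3 ^ 12 := by
    rw [← hfin, ← Algebra.norm_algebraMap]
    simp
  rw [map_mul, map_mul, map_mul, h2, h4, h8, h3] at hprod
  rw [Ideal.absNorm_span_singleton, norm_gaussian_period hζ k hk]
  refine Nat.pow_left_injective (n := 4) (by norm_num) ?_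
  simp only [← Int.natAbs_pow]
  rw [show ∀ a : ℤ, a ^ 4 = a * a * a * a by intro a; ring, hprod]
  norm_num

theorem isPrincipal_of_mem_primesOver_three (hζ : IsPrimitiveRoot ζ 13) (P : Ideal (𝓞 K))
    (hP : P ∈ Ideal.primesOver (Ideal.span {((3 : ℕ) : ℤ)}) (𝓞 K)) :
    Submodule.IsPrincipal P := by
  have : Fact (Nat.Prime 3) := ⟨Nat.prime_three⟩
  have hP₁ : P.IsPrime := hP.1
  have hP₂ : P.LiesOver (Ideal.span {((3 : ℕ) : ℤ)}) := hP.2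
  have habsP : Ideal.absNorm P = 27 := by
    have hord : orderOf ((3 : ℕ) : ZMod 13) = 3 :=
      orderOf_eq_prime (by decide) (by decide)
    have h := Ideal.natAbs_pow_inertiaDeg ((3 : ℕ) : ℤ) P
    rw [IsCyclotomicExtension.Rat.inertiaDeg_eq_of_not_dvd 3 K P (m := 13) (by norm_num), hord] at h
    simpa using h.symm
  have hmain {k : ℕ} (hk : k.Coprime 13)
      (hmem : hζ.toInteger ^ k + hζ.toInteger ^ (3 * k) + hζ.toInteger ^ (9 * k) ∈ P) :
      Submodule.IsPrincipal P := by
    obtain ⟨J, hJ⟩ := Ideal.dvd_iff_le.mpr ((Ideal.span_singleton_le_iff_mem P).mpr hmem)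
    have hJ1 := congrArg Ideal.absNorm hJ
    rw [map_mul, absNorm_span_gaussian_period hζ k hk, habsP] at hJ1
    rw [Ideal.absNorm_eq_one_iff.mp (by lia : Ideal.absNorm J = 1), Ideal.mul_top] at hJ
    exact ⟨_, hJ.symm⟩
  have h3P : (3 : 𝓞 K) ∈ P := by
    have h : ((3 : ℕ) : ℤ) ∈ P.under ℤ := by
      rw [← Ideal.over_def P (Ideal.span {((3 : ℕ) : ℤ)})]
      exact Ideal.mem_span_singleton_self _
    simpa [Ideal.under_def] using h
  have hpow (i j : ℕ) : hζ.toInteger ^ (13 * i + j) = hζ.toInteger ^ j := by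
    rw [pow_add, pow_mul, hζ.toInteger_isPrimitiveRoot.pow_eq_one, one_pow, one_mul]
  rw [← prod_gaussian_periods (sum_pow_toInteger_eq_zero hζ)] at h3P
  rcases hP₁.mem_or_mem h3P with h | h
  · rcases hP₁.mem_or_mem h with h | h
    · rcases hP₁.mem_or_mem h with h | h
      · exact hmain (k := 1) (by norm_num) (by simpa using h)
      · refine hmain (k := 2) (by norm_num) ?_
        rwa [show 9 * 2 = 13 * 1 + 5 by norm_num, hpow]
    · refine hmain (k := 4) (by norm_num) ?_
      rwa [show 9 * 4 = 13 * 2 + 10 by norm_num, hpow]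
  · refine hmain (k := 8) (by norm_num) ?_
    rwa [show 3 * 8 = 13 * 1 + 11 by norm_num, show 9 * 8 = 13 * 5 + 7 by norm_num, hpow, hpow]

theorem minkowskiBound_lt :
    (4 / Real.pi) ^ 6 * (Nat.factorial 12 / 12 ^ 12 * √(13 ^ 11)) < 307 := by
  have hsqrt : √(13 ^ 11 : ℝ) < 1338750 := by
    rw [Real.sqrt_lt' (by norm_num)]
    norm_num
  have hpi : 4 / Real.pi < 4 / 3.141 := by
    have := Real.pi_gt_d4
    gcongr
    linarith
  have hpi0 := Real.pi_pos
  calc (4 / Real.pi) ^ 6 * (Nat.factorial 12 / 12 ^ 12 * √(13 ^ 11))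
      ≤ (4 / 3.141) ^ 6 * (Nat.factorial 12 / 12 ^ 12 * 1338750) := by gcongr
    _ < 307 := by norm_num [Nat.factorial]

theorem mem_of_pow_le_of_pow_mod_thirteen :
    ∀ p ∈ Finset.Icc 1 306, ∀ f ∈ Finset.Icc 1 8, p ^ f ≤ 306 → p ^ f % 13 = 1 → p.Prime →
      p = 3 ∨ p = 53 ∨ p = 79 ∨ p = 131 ∨ p = 157 := by
  decide +kernel

variable (K) in
/-- The ring of integers of the thirteenth cyclotomic field is a principal ideal domain. -/
theorem isPrincipalIdealRing_ringOfIntegers : IsPrincipalIdealRing (𝓞 K) := by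
  have : IsGalois ℚ K := IsCyclotomicExtension.isGalois {13} ℚ K
  apply RingOfIntegers.isPrincipalIdealRing_of_isPrincipal_of_lt_or_isPrincipal_of_mem_primesOver_of_mem_Icc
  have hfloor : ⌊(4 / Real.pi) ^ InfinitePlace.nrComplexPlaces K *
      ((Module.finrank ℚ K).factorial / (Module.finrank ℚ K) ^ (Module.finrank ℚ K) *
        √|discr K|)⌋₊ ≤ 306 := by
    rw [IsCyclotomicExtension.Rat.discr_prime 13 K, IsCyclotomicExtension.Rat.finrank 13 K,
      IsCyclotomicExtension.Rat.nrComplexPlaces_eq_totient_div_two 13,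
      Nat.totient_prime (by norm_num)]
    refine Nat.le_of_lt_succ ((Nat.floor_lt (by positivity)).mpr ?_)
    have h := minkowskiBound_lt
    norm_num at h ⊢
    exact h
  have hζ := IsCyclotomicExtension.zeta_spec 13 ℚ K
  have hsum := sum_pow_toInteger_eq_zero hζ
  intro p hp hprime
  have hpf : Fact p.Prime := ⟨hprime⟩
  have hpspan : (Ideal.span {(p : ℤ)}).IsPrime :=
    (Ideal.span_singleton_prime (by exact_mod_cast hprime.ne_zero)).mpr
      (Nat.prime_iff_prime_int.mp hprime)
  by_cases h13 : p = 13
  · subst h13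
    obtain ⟨P, hP⟩ := (Ideal.span {((13 : ℕ) : ℤ)}).nonempty_primesOver (S := 𝓞 K)
    have hP₁ := hP.1
    have hP₂ := hP.2
    exact ⟨P, hP, Or.inr
      ⟨_, IsCyclotomicExtension.Rat.eq_span_zeta_sub_one_of_liesOver' 13 K hζ P⟩⟩
  by_cases hlist : p = 3 ∨ p = 53 ∨ p = 79 ∨ p = 131 ∨ p = 157
  · have key : ∃ P ∈ Ideal.primesOver (Ideal.span {(p : ℤ)}) (𝓞 K), Submodule.IsPrincipal P := by
      have hcyc (q : ℕ) (g : ℤ) : (cyclotomic 13 ℤ).aeval (g : ZMod q) =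
          ∑ i ∈ Finset.range 13, (g : ZMod q) ^ i := by
        simp [cyclotomic_prime]
      rcases hlist with rfl | rfl | rfl | rfl | rfl
      · obtain ⟨P⟩ := (Ideal.span {((3 : ℕ) : ℤ)}).nonempty_primesOver (S := 𝓞 K)
        exact ⟨P, P.2, isPrincipal_of_mem_primesOver_three hζ P P.2⟩
      · refine exists_isPrincipal_mem_primesOver hζ (g := 36) hprime ?_ (1 + X + X ^ 3) ?_ ?_ ?_
        · rw [hcyc]; decide
        · simpa using (by decide +revert : (1 + 36 + 36 ^ 3 : ZMod 53) = 0)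
        · simpa using (dvd_certificate_fiftyThree hsum).1
        · simpa using (dvd_certificate_fiftyThree hsum).2
      · refine exists_isPrincipal_mem_primesOver hζ (g := 64) hprime ?_ (1 + X - X ^ 4) ?_ ?_ ?_
        · rw [hcyc]; decide
        · simpa using (by decide +revert : (1 + 64 - 64 ^ 4 : ZMod 79) = 0)
        · simpa using (dvd_certificate_seventyNine hsum).1
        · simpa using (dvd_certificate_seventyNine hsum).2
      · refine exists_isPrincipal_mem_primesOver hζ (g := 80) hprime ?_ (1 - X - X ^ 3) ?_ ?_ ?_
        · rw [hcyc]; decide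
        · simpa using (by decide +revert : (1 - 80 - 80 ^ 3 : ZMod 131) = 0)
        · simpa using (dvd_certificate_oneHundredThirtyOne hsum).1
        · simpa using (dvd_certificate_oneHundredThirtyOne hsum).2
      · refine exists_isPrincipal_mem_primesOver hζ (g := 75) hprime ?_
          (1 - X + X ^ 2 + X ^ 4) ?_ ?_ ?_
        · rw [hcyc]; decide
        · simpa using (by decide +revert +kernel : (1 - 75 + 75 ^ 2 + 75 ^ 4 : ZMod 157) = 0)
        · simpa using (dvd_certificate_oneHundredFiftySeven hsum).1
        · simpa using (dvd_certificate_oneHundredFiftySeven hsum).2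
    obtain ⟨P, hP, hP'⟩ := key
    exact ⟨P, hP, Or.inr hP'⟩
  · obtain ⟨P, hP⟩ := (Ideal.span {(p : ℤ)}).nonempty_primesOver (S := 𝓞 K)
    have hP₁ := hP.1
    have hP₂ := hP.2
    refine ⟨P, hP, Or.inl (lt_of_not_ge fun hle ↦ hlist ?_)⟩
    have hnd : ¬ p ∣ 13 := fun h ↦ h13 ((Nat.prime_dvd_prime_iff_eq hprime (by norm_num)).mp h)
    rw [IsCyclotomicExtension.Rat.inertiaDeg_eq_of_not_dvd p K P (m := 13) hnd] at hle
    replace hle := hle.trans hfloor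
    have hp' := Finset.mem_Icc.mp hp
    refine mem_of_pow_le_of_pow_mod_thirteen p
      (Finset.mem_Icc.mpr ⟨hp'.1, hp'.2.trans hfloor⟩) (orderOf (p : ZMod 13)) ?_ hle ?_ hprime
    · refine Finset.mem_Icc.mpr ⟨?_, ?_⟩
      · have hp0 : (p : ZMod 13) ≠ 0 := fun h ↦ h13
          ((Nat.prime_dvd_prime_iff_eq (by norm_num) hprime).mp
            ((ZMod.natCast_eq_zero_iff p 13).mp h)).symm
        exact orderOf_pos_iff.mpr (isOfFinOrder_iff_pow_eq_one.mpr
          ⟨12, by norm_num, ZMod.pow_card_sub_one_eq_one hp0⟩)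
      · by_contra! h9
        have h1 : 2 ^ 9 ≤ p ^ orderOf (p : ZMod 13) :=
          (Nat.pow_le_pow_left hprime.two_le 9).trans (Nat.pow_le_pow_right hprime.pos h9)
        lia
    · have h1 := pow_orderOf_eq_one (p : ZMod 13)
      rw [← Nat.cast_pow, ← Nat.cast_one, ZMod.natCast_eq_natCast_iff'] at h1
      simpa using h1

theorem thirteen_dvd_of_thirteen_dvd_prod_pow_sub {i d₂ d₃ d₄ d₅ d₆ : ℕ} {n : ℤ}
    (h : (13 : 𝓞 K) ∣ hζ.toInteger ^ i * (∑ k ∈ Finset.range 2, hζ.toInteger ^ k) ^ d₂ *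
      (∑ k ∈ Finset.range 3, hζ.toInteger ^ k) ^ d₃ *
      (∑ k ∈ Finset.range 4, hζ.toInteger ^ k) ^ d₄ *
      (∑ k ∈ Finset.range 5, hζ.toInteger ^ k) ^ d₅ *
      (∑ k ∈ Finset.range 6, hζ.toInteger ^ k) ^ d₆ - n) :
    13 ∣ i ∧ 13 ∣ d₂ ∧ 13 ∣ d₃ ∧ 13 ∣ d₄ ∧ 13 ∣ d₅ ∧ 13 ∣ d₆ := by
  obtain ⟨w, hw⟩ := h
  obtain ⟨q, rfl⟩ := exists_aeval_toInteger_eq hζ w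
  have hroot : aeval hζ.toInteger (X ^ i * (∑ k ∈ Finset.range 2, X ^ k) ^ d₂ *
      (∑ k ∈ Finset.range 3, X ^ k) ^ d₃ * (∑ k ∈ Finset.range 4, X ^ k) ^ d₄ *
      (∑ k ∈ Finset.range 5, X ^ k) ^ d₅ * (∑ k ∈ Finset.range 6, X ^ k) ^ d₆ -
      (n : ℤ[X]) - 13 * q) = 0 := by
    simp only [map_sub, map_mul, map_pow, map_sum, aeval_X, map_intCast, map_ofNat, hw, sub_self]
  have hdvd := minpoly.isIntegrallyClosed_dvd (RingOfIntegers.isIntegral _) hroot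
  rw [minpoly_toInteger] at hdvd
  have hmap := map_dvd (compRingHom (X + 1))
    (map_dvd (mapRingHom (Int.castRingHom (ZMod 13))) hdvd)
  have hcyc : cyclotomic 13 (ZMod 13) = (X - 1) ^ 12 := by
    simpa using cyclotomic_mul_prime_eq_pow_of_not_dvd (ZMod 13) (p := 13) (n := 1) (by norm_num)
  simp only [coe_mapRingHom, map_cyclotomic, hcyc, coe_compRingHom_apply, Polynomial.map_sub,
    Polynomial.map_mul, Polynomial.map_pow, Polynomial.map_sum, map_X, Polynomial.map_intCast,
    Polynomial.map_ofNat, thirteen_eq_zero, zero_mul, sub_zero, sub_comp, mul_comp, pow_comp,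
    X_comp, one_comp, add_sub_cancel_right, intCast_comp] at hmap
  have key := natCast_eq_zero_of_X_pow_dvd (i := i) (d₂ := d₂) (d₃ := d₃) (d₄ := d₄) (d₅ := d₅)
    (d₆ := d₆) (n := (n : ZMod 13)) (by
      convert hmap using 8 <;> simp [Finset.sum_range_succ] <;> ring)
  simpa only [ZMod.natCast_eq_zero_iff] using key

/-- A family of `n` elements that is independent modulo `p`-th powers in an abelian group generated
by `n` elements generates the group modulo `p`-th powers. -/
theorem exists_eq_prod_pow_mul_pow {G : Type*} [CommGroup G] {p n : ℕ} (hp : 0 < p)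
    {g c : Fin n → G} (hg : ∀ x, ∃ e : Fin n → ℤ, x = ∏ k, g k ^ e k)
    (hc : ∀ (e : Fin n → ℕ) (v : G), ∏ k, c k ^ e k = v ^ p → ∀ k, p ∣ e k) (x : G) :
    ∃ (e : Fin n → ℕ) (v : G), x = (∏ k, c k ^ e k) * v ^ p := by
  let N := (powMonoidHom p : G →* G).range
  let mkProd (a : Fin n → G) (e : Fin n → Fin p) : G ⧸ N :=
    ((∏ k, a k ^ (e k : ℕ) : G) : G ⧸ N)
  have hsurj : Function.Surjective (mkProd g) := by
    intro y
    obtain ⟨x, rfl⟩ := QuotientGroup.mk_surjective y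
    obtain ⟨e, rfl⟩ := hg x
    have hmod (k : Fin n) : 0 ≤ e k % p ∧ e k % p < p :=
      ⟨Int.emod_nonneg _ (by lia), Int.emod_lt_of_pos _ (by lia)⟩
    refine ⟨fun k ↦ ⟨(e k % p).toNat, by have := hmod k; lia⟩, QuotientGroup.eq.mpr
      ⟨∏ k, g k ^ (e k / p), ?_⟩⟩
    rw [powMonoidHom_apply, eq_inv_mul_iff_mul_eq, ← Finset.prod_pow, ← Finset.prod_mul_distrib]
    refine Finset.prod_congr rfl fun k _ ↦ ?_
    rw [← zpow_natCast, ← zpow_natCast, ← zpow_mul, ← zpow_add, Int.toNat_of_nonneg (hmod k).1,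
      mul_comm, Int.emod_add_mul_ediv]
  have hinj : Function.Injective (mkProd c) := by
    intro e e' h
    obtain ⟨v, hv⟩ := QuotientGroup.eq.mp h
    rw [powMonoidHom_apply, eq_inv_mul_iff_mul_eq] at hv
    have key := hc (fun k ↦ e' k + (p - e k)) (v * ∏ k, c k) (by
      refine mul_left_cancel (a := ∏ k, c k ^ (e k : ℕ)) ?_
      rw [mul_pow, ← mul_assoc, hv, ← Finset.prod_pow, ← Finset.prod_mul_distrib,
        ← Finset.prod_mul_distrib]
      refine Finset.prod_congr rfl fun k _ ↦ ?_
      rw [← pow_add, ← pow_add]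
      congr 1
      lia)
    ext k
    have h₁ := (e k).2
    have h₂ := (e' k).2
    have h₃ : (e' k + (p - e k) : ℕ) = p := Nat.eq_of_dvd_of_lt_two_mul (by lia) (key k) (by lia)
    lia
  have : Finite (G ⧸ N) := Finite.of_surjective _ hsurj
  obtain ⟨e, he⟩ := (hinj.bijective_of_nat_card_le
    (Nat.card_le_card_of_surjective _ hsurj)).2 (x : G ⧸ N)
  obtain ⟨v, hv⟩ := QuotientGroup.eq.mp he
  exact ⟨fun k ↦ e k, v, (eq_inv_mul_iff_mul_eq.mp hv).symm⟩

variable (K) in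
theorem exists_forall_eq_prod_zpow :
    ∃ g : Fin 6 → (𝓞 K)ˣ, ∀ u, ∃ e : Fin 6 → ℤ, u = ∏ k, g k ^ e k := by
  have hrank : Units.rank K = 5 := by
    rw [Units.rank, InfinitePlace.card_eq_nrRealPlaces_add_nrComplexPlaces,
      IsCyclotomicExtension.Rat.nrRealPlaces_eq_zero (n := 13) K (by decide), zero_add,
      IsCyclotomicExtension.Rat.nrComplexPlaces_eq_totient_div_two 13]
    decide
  obtain ⟨t, ht⟩ := IsCyclic.exists_generator (α := Units.torsion K)
  refine ⟨Fin.cons (t : (𝓞 K)ˣ) (Units.fundSystem K ∘ Fin.cast hrank.symm), fun u ↦ ?_⟩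
  obtain ⟨⟨s, e⟩, hu, -⟩ := Units.exist_unique_eq_mul_prod K u
  obtain ⟨m, rfl⟩ := Subgroup.mem_zpowers_iff.mp (ht s)
  refine ⟨Fin.cons m (e ∘ Fin.cast hrank.symm), ?_⟩
  rw [hu, Fin.prod_univ_succ]
  simp only [Fin.cons_zero, Fin.cons_succ, Function.comp_apply, Subgroup.coe_zpow]
  congr 1
  exact (Equiv.prod_comp (finCongr hrank.symm) fun k ↦ Units.fundSystem K k ^ e k).symm

/-- Thirteenth powers are rational modulo `13`. -/
theorem exists_int_thirteen_dvd_pow_sub (hζ : IsPrimitiveRoot ζ 13) (x : 𝓞 K) :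
    ∃ n : ℤ, (13 : 𝓞 K) ∣ x ^ 13 - n := by
  obtain ⟨f, rfl⟩ := exists_aeval_toInteger_eq hζ x
  induction f using Polynomial.induction_on' with
  | add p q hp hq =>
    obtain ⟨m, hm⟩ := hp
    obtain ⟨n, hn⟩ := hq
    refine ⟨m + n, ?_⟩
    obtain ⟨r, hr⟩ := exists_add_pow_prime_eq (p := 13) (by norm_num)
      (aeval hζ.toInteger p) (aeval hζ.toInteger q)
    rw [map_add, hr]
    push_cast
    convert (dvd_add hm hn).add
      (dvd_mul_right 13 (aeval hζ.toInteger p * aeval hζ.toInteger q * r)) using 1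
    ring
  | monomial n a =>
    refine ⟨a ^ 13, ?_⟩
    simp [aeval_monomial, mul_pow, ← pow_mul, mul_comm n 13]
    simp [pow_mul, hζ.toInteger_isPrimitiveRoot.pow_eq_one]

theorem exists_units_forall_thirteen_dvd (hζ : IsPrimitiveRoot ζ 13) :
    ∃ c : Fin 6 → (𝓞 K)ˣ, ∀ (e : Fin 6 → ℕ) (n : ℤ),
      (13 : 𝓞 K) ∣ ((∏ k, c k ^ e k : (𝓞 K)ˣ) : 𝓞 K) - n → ∀ k, 13 ∣ e k := by
  have hz := hζ.toInteger_isPrimitiveRoot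
  have hgeom (j : ℕ) (hj : j.Coprime 13) := hz.geom_sum_isUnit (by norm_num) hj
  refine ⟨![(hz.isUnit (by norm_num)).unit, (hgeom 2 (by norm_num)).unit,
    (hgeom 3 (by norm_num)).unit, (hgeom 4 (by norm_num)).unit, (hgeom 5 (by norm_num)).unit,
    (hgeom 6 (by norm_num)).unit], fun e n h ↦ ?_⟩
  simp only [Fin.prod_univ_six, Units.val_mul, Units.val_pow_eq_pow_val] at h
  obtain ⟨h₀, h₁, h₂, h₃, h₄, h₅⟩ := thirteen_dvd_of_thirteen_dvd_prod_pow_sub hζ (i := e 0)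
    (d₂ := e 1) (d₃ := e 2) (d₄ := e 3) (d₅ := e 4) (d₆ := e 5) (n := n) h
  intro k
  fin_cases k <;> assumption

/-- **Kummer's lemma** for the exponent `13`. -/
theorem exists_eq_pow_thirteen_of_thirteen_dvd_sub (hζ : IsPrimitiveRoot ζ 13) {u : (𝓞 K)ˣ}
    {n : ℤ} (hu : (13 : 𝓞 K) ∣ (u : 𝓞 K) - n) : ∃ v : (𝓞 K)ˣ, u = v ^ 13 := by
  obtain ⟨g, hg⟩ := exists_forall_eq_prod_zpow K
  obtain ⟨c, hc⟩ := exists_units_forall_thirteen_dvd hζ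
  obtain ⟨e, v, hev⟩ := exists_eq_prod_pow_mul_pow (p := 13) (by norm_num) hg (c := c)
    (fun e v h ↦ by
      obtain ⟨m, hm⟩ := exists_int_thirteen_dvd_pow_sub hζ (v : 𝓞 K)
      exact hc e m (by rw [h]; simpa using hm)) u
  obtain ⟨m, hm⟩ := exists_int_thirteen_dvd_pow_sub hζ ((v⁻¹ : (𝓞 K)ˣ) : 𝓞 K)
  have hdvd := hc e (n * m) (by
    rw [← mul_inv_eq_iff_eq_mul.mpr hev, ← inv_pow]
    convert dvd_add (hu.mul_right ((v⁻¹ : (𝓞 K)ˣ) ^ 13 : 𝓞 K)) (hm.mul_left (n : 𝓞 K)) using 1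
    push_cast
    ring)
  choose f hf using hdvd
  refine ⟨(∏ k, c k ^ f k) * v, ?_⟩
  rw [hev, mul_pow, ← Finset.prod_pow]
  congr 1
  exact Finset.prod_congr rfl fun k _ ↦ by rw [hf k, mul_comm, pow_mul]

theorem pow_add_pow_eq_prod_range {R : Type*} [CommRing R] [IsDomain R] {z : R} {n : ℕ}
    (hz : IsPrimitiveRoot z n) (hn : Odd n) (x y : R) :
    x ^ n + y ^ n = ∏ i ∈ Finset.range n, (x + z ^ i * y) := by
  classical
  have himage : nthRootsFinset n (1 : R) = (Finset.range n).image (z ^ ·) := by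
    refine (Finset.eq_of_subset_of_card_le (fun w hw ↦ ?_) ?_).symm
    · obtain ⟨i, -, rfl⟩ := Finset.mem_image.mp hw
      rw [mem_nthRootsFinset hn.pos, ← pow_mul, mul_comm, pow_mul, hz.pow_eq_one, one_pow]
    · rw [hz.card_nthRootsFinset, Finset.card_image_of_injOn, Finset.card_range]
      exact fun i hi j hj ↦ hz.pow_inj (Finset.mem_range.mp hi) (Finset.mem_range.mp hj)
  rw [hz.pow_add_pow_eq_prod_add_mul x y hn, himage, Finset.prod_image]
  exact fun i hi j hj ↦ hz.pow_inj (Finset.mem_range.mp hi) (Finset.mem_range.mp hj)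

theorem exists_associated_pow_of_associated_pow_prod {ι R : Type*} [CommRing R] [IsDomain R]
    [IsBezout R] {n : ℕ} {c : R} {s : Finset ι} {f : ι → R}
    (hf : (s : Set ι).Pairwise fun i j ↦ IsCoprime (f i) (f j))
    (h : Associated (c ^ n) (∏ i ∈ s, f i)) {i : ι} (hi : i ∈ s) :
    ∃ d : R, Associated (d ^ n) (f i) := by
  classical
  rw [← Finset.mul_prod_erase s f hi] at h
  refine exists_associated_pow_of_associated_pow_mul (IsCoprime.prod_right fun j hj ↦ ?_) h
  rw [Finset.mem_erase] at hj
  exact hf hi hj.2 hj.1.symm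

theorem exists_sq_dvd_add_pow_mul {x y : 𝓞 K} (hy : ¬ hζ.toInteger - 1 ∣ y)
    (h : hζ.toInteger - 1 ∣ x ^ 13 + y ^ 13) :
    ∃ i, (hζ.toInteger - 1) ^ 2 ∣ x + hζ.toInteger ^ i * y := by
  have hz := hζ.toInteger_isPrimitiveRoot
  have hprime := hζ.zeta_sub_one_prime'
  rw [pow_add_pow_eq_prod_range hz (by decide) x y, hprime.dvd_finsetProd_iff] at h
  obtain ⟨j, -, hj⟩ := h
  have hxy : hζ.toInteger - 1 ∣ x + y := by
    convert dvd_sub hj ((sub_one_dvd_pow_sub_one hζ.toInteger j).mul_right y) using 1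
    ring
  obtain ⟨s, hs⟩ := hxy
  have hself : hζ.toInteger - 1 ∣ hζ.toInteger - ((1 : ℤ) : 𝓞 K) := by simp
  obtain ⟨a, ha⟩ := exists_int_dvd_sub hζ hself s
  obtain ⟨b, hb⟩ := exists_int_dvd_sub hζ hself y
  have hb13 : ¬ (13 : ℤ) ∣ b := fun h13 ↦ hy <| (dvd_sub_left
    ((IsCyclotomicExtension.Rat.zeta_sub_one_dvd_intCast_iff' 13 hζ).mpr h13)).mp hb
  obtain ⟨i, hi⟩ : ∃ i : ℕ, (13 : ℤ) ∣ a + i * b := by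
    have hb0 : (b : ZMod 13) ≠ 0 := by rwa [Ne, ZMod.intCast_zmod_eq_zero_iff_dvd]
    refine ⟨(-a / b : ZMod 13).val, ?_⟩
    rw [← Nat.cast_ofNat, ← ZMod.intCast_zmod_eq_zero_iff_dvd]
    push_cast
    rw [ZMod.natCast_zmod_val]
    field_simp
    ring
  refine ⟨i, ?_⟩
  have hfactor : x + hζ.toInteger ^ i * y =
      (hζ.toInteger - 1) * (s + (∑ k ∈ Finset.range i, hζ.toInteger ^ k) * y) := by
    linear_combination hs - y * mul_geom_sum hζ.toInteger i
  rw [hfactor, sq]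
  refine mul_dvd_mul_left _ ?_
  have hgeom : hζ.toInteger - 1 ∣ (∑ k ∈ Finset.range i, hζ.toInteger ^ k) - i := by
    have hi : (i : 𝓞 K) = ∑ k ∈ Finset.range i, 1 := by simp
    rw [hi, ← Finset.sum_sub_distrib]
    exact Finset.dvd_sum fun k _ ↦ sub_one_dvd_pow_sub_one _ k
  have hi' := (IsCyclotomicExtension.Rat.zeta_sub_one_dvd_intCast_iff' 13 hζ).mpr hi
  push_cast at hi'
  convert ((ha.add (hgeom.mul_right y)).add (hb.mul_left (i : 𝓞 K))).add hi' using 1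
  ring

theorem exists_descent {k : ℕ} {x y w : 𝓞 K} {ε : (𝓞 K)ˣ}
    (hxy : IsCoprime x y) (hy : ¬ hζ.toInteger - 1 ∣ y) (hw : ¬ hζ.toInteger - 1 ∣ w)
    (hsq : (hζ.toInteger - 1) ^ 2 ∣ x + y)
    (h : x ^ 13 + y ^ 13 = ε * (hζ.toInteger - 1) ^ (13 * (k + 1)) * w ^ 13) :
    k ≠ 0 ∧ ∃ (w₀ w₁ w₂ : 𝓞 K) (η η' : (𝓞 K)ˣ), IsCoprime w₁ w₂ ∧ ¬ hζ.toInteger - 1 ∣ w₂ ∧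
      ¬ hζ.toInteger - 1 ∣ w₀ ∧
      w₁ ^ 13 + η * w₂ ^ 13 = η' * (hζ.toInteger - 1) ^ (13 * k) * w₀ ^ 13 := by
  have hPID := isPrincipalIdealRing_ringOfIntegers K
  have hz := hζ.toInteger_isPrimitiveRoot
  have hprime := hζ.zeta_sub_one_prime'
  rw [pow_add_pow_eq_prod_range hz (by decide) x y] at h
  set z := hζ.toInteger
  have hunit {j : ℕ} (hj : 0 < j) (hj' : j < 13) : IsUnit (∑ i ∈ Finset.range j, z ^ i) :=
    hz.geom_sum_isUnit (by norm_num) (Nat.coprime_of_lt_prime hj.ne' hj' (by norm_num)).symm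
  obtain ⟨r, hr⟩ := hsq
  let s (i : ℕ) : 𝓞 K := (z - 1) * r + (∑ k ∈ Finset.range i, z ^ k) * y
  have hs (i : ℕ) : x + z ^ i * y = (z - 1) * s i := by
    simp only [s]
    linear_combination hr - y * mul_geom_sum z i
  have hs_not_dvd {i : ℕ} (hi : 0 < i) (hi' : i < 13) : ¬ z - 1 ∣ s i := by
    rw [dvd_add_right (dvd_mul_right _ _), (hunit hi hi').dvd_mul_left]
    exact hy
  have hcop_of_lt {i j : ℕ} (hij : i < j) (hj : j < 13) : IsCoprime (s i) (s j) := by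
    have h₁ : IsCoprime (s i) y := by
      refine IsCoprime.of_mul_left_right (x := z - 1) ?_
      rw [← hs]
      exact hxy.add_mul_right_left _
    have h₂ : IsUnit (z ^ i * ∑ k ∈ Finset.range (j - i), z ^ k) :=
      ((hz.isUnit (by norm_num)).pow i).mul (hunit (by lia) (by lia))
    have h₃ := ((isCoprime_mul_unit_left_right h₂ (s i) y).mpr h₁).add_mul_left_right 1
    convert h₃ using 1
    have h₄ : ∑ k ∈ Finset.range j, z ^ k = ∑ k ∈ Finset.range i, z ^ k +
        z ^ i * ∑ k ∈ Finset.range (j - i), z ^ k := by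
      obtain ⟨m, rfl⟩ := Nat.exists_eq_add_of_lt hij
      rw [add_assoc, Finset.sum_range_add, Nat.add_sub_cancel_left, Finset.mul_sum]
      simp only [pow_add]
    simp only [s, h₄]
    ring
  have hcop {i j : ℕ} (hi : i < 13) (hj : j < 13) (hij : i ≠ j) : IsCoprime (s i) (s j) := by
    rcases hij.lt_or_gt with h | h
    · exact hcop_of_lt h hj
    · exact (hcop_of_lt h hi).symm
  simp only [hs, Finset.prod_mul_distrib, Finset.prod_const, Finset.card_range] at h
  replace h : s 0 * ∏ i ∈ Finset.range 12, s (i + 1) = ε * (z - 1) ^ (13 * k) * w ^ 13 := by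
    refine mul_left_cancel₀ (pow_ne_zero 13 hprime.ne_zero) ?_
    rw [mul_comm (s 0), ← Finset.prod_range_succ', h]
    ring
  have hprod : ¬ z - 1 ∣ ∏ i ∈ Finset.range 12, s (i + 1) := by
    rw [hprime.dvd_finsetProd_iff]
    rintro ⟨i, hi, hdvd⟩
    exact hs_not_dvd (by lia) (by have := Finset.mem_range.mp hi; lia) hdvd
  obtain ⟨t, ht⟩ : (z - 1) ^ (13 * k) ∣ s 0 := by
    refine hprime.pow_dvd_of_dvd_mul_right _ hprod ?_
    rw [h]
    exact ⟨ε * w ^ 13, by ring⟩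
  have hεw : ¬ z - 1 ∣ ε * w ^ 13 := by
    rw [ε.isUnit.dvd_mul_left]
    exact fun hdvd ↦ hw (hprime.dvd_of_dvd_pow hdvd)
  replace h : t * ∏ i ∈ Finset.range 12, s (i + 1) = ε * w ^ 13 := by
    refine mul_left_cancel₀ (pow_ne_zero (13 * k) hprime.ne_zero) ?_
    linear_combination h - (∏ i ∈ Finset.range 12, s (i + 1)) * ht
  have ht_not_dvd : ¬ z - 1 ∣ t := fun hdvd ↦ hεw (h ▸ hdvd.mul_right _)
  refine ⟨?_, ?_⟩
  · rintro rfl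
    refine ht_not_dvd ?_
    rw [mul_zero, pow_zero, one_mul] at ht
    rw [← ht]
    simp [s]
  let f (i : ℕ) : 𝓞 K := if i = 0 then t else s i
  have hf_cop : (Finset.range 13 : Set ℕ).Pairwise fun i j ↦ IsCoprime (f i) (f j) := by
    intro i hi j hj hij
    have hdvd (i : ℕ) : f i ∣ s i := by
      by_cases hi0 : i = 0
      · simp [f, hi0, ht]
      · simp [f, hi0]
    exact ((hcop (by simpa using hi) (by simpa using hj) hij).of_isCoprime_of_dvd_left
      (hdvd i)).of_isCoprime_of_dvd_right (hdvd j)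
  have hf_prod : Associated (w ^ 13) (∏ i ∈ Finset.range 13, f i) := by
    refine ⟨ε, ?_⟩
    rw [Finset.prod_range_succ', mul_comm, ← h]
    simp [f, mul_comm]
  obtain ⟨w₀, u₀, h₀⟩ := exists_associated_pow_of_associated_pow_prod hf_cop hf_prod
    (i := 0) (by simp)
  obtain ⟨w₁, u₁, h₁⟩ := exists_associated_pow_of_associated_pow_prod hf_cop hf_prod
    (i := 1) (by simp)
  obtain ⟨w₂, u₂, h₂⟩ := exists_associated_pow_of_associated_pow_prod hf_cop hf_prod
    (i := 12) (by simp)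
  simp only [f, if_true, one_ne_zero, if_false, OfNat.ofNat_ne_zero] at h₀ h₁ h₂
  have hrel : s 1 + z * s 12 = (1 + z) * s 0 := by
    refine mul_left_cancel₀ hprime.ne_zero ?_
    linear_combination -hs 1 - z * hs 12 + (1 + z) * hs 0 + y * hz.pow_eq_one
  have h2unit : IsUnit (1 + z) := by
    simpa [Finset.sum_range_succ] using hunit (j := 2) (by norm_num) (by norm_num)
  obtain ⟨a, ha⟩ := h2unit
  obtain ⟨b, hb⟩ := hz.isUnit (by norm_num)
  refine ⟨w₀, w₁, w₂, u₁⁻¹ * b * u₂, u₁⁻¹ * a * u₀, ?_, ?_, ?_, ?_⟩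
  · have hc : IsCoprime (s 1) (s 12) := hcop (by norm_num) (by norm_num) (by norm_num)
    rw [← h₁, ← h₂] at hc
    exact (IsCoprime.pow_iff (by norm_num) (by norm_num)).mp
      hc.of_mul_left_left.of_mul_right_left
  · intro hdvd
    refine hs_not_dvd (i := 12) (by norm_num) (by norm_num) ?_
    rw [← h₂]
    exact (dvd_pow hdvd (by norm_num)).mul_right _
  · intro hdvd
    refine ht_not_dvd ?_
    rw [← h₀]
    exact (dvd_pow hdvd (by norm_num)).mul_right _
  · refine mul_left_cancel₀ u₁.ne_zero ?_
    push_cast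
    rw [ha, hb]
    rw [ht, ← h₀, ← h₁, ← h₂] at hrel
    linear_combination hrel + (z * u₂ * w₂ ^ 13 - (1 + z) * u₀ * (z - 1) ^ (13 * k) * w₀ ^ 13) *
      u₁.mul_inv

theorem exists_eq_pow_thirteen_of_dvd_add {x y : 𝓞 K} {η : (𝓞 K)ˣ}
    (hy : ¬ hζ.toInteger - 1 ∣ y) (h : (13 : 𝓞 K) ∣ x ^ 13 + η * y ^ 13) :
    ∃ v : (𝓞 K)ˣ, η = v ^ 13 := by
  obtain ⟨a, ha⟩ := exists_int_thirteen_dvd_pow_sub hζ x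
  obtain ⟨b, hb⟩ := exists_int_thirteen_dvd_pow_sub hζ y
  have hdvd13 : hζ.toInteger - 1 ∣ (13 : 𝓞 K) := by
    exact_mod_cast (IsCyclotomicExtension.Rat.zeta_sub_one_dvd_intCast_iff' 13 hζ).mpr dvd_rfl
  have hb13 : ¬ (13 : ℤ) ∣ b := fun h13 ↦ hy <| hζ.zeta_sub_one_prime'.dvd_of_dvd_pow <|
    (dvd_sub_left ((IsCyclotomicExtension.Rat.zeta_sub_one_dvd_intCast_iff' 13 hζ).mpr h13)).mp
      (hdvd13.trans hb)
  obtain ⟨c, d, hcd⟩ : IsCoprime b 13 :=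
    ((Int.prime_iff_natAbs_prime.mpr (by norm_num)).coprime_iff_not_dvd.mpr hb13).symm
  have hcd' : (c : 𝓞 K) * b + d * 13 = 1 := by exact_mod_cast congrArg (Int.cast (R := 𝓞 K)) hcd
  refine exists_eq_pow_thirteen_of_thirteen_dvd_sub hζ (n := -a * c) ?_
  have key := (((h.sub ha).sub (hb.mul_left (η : 𝓞 K))).mul_left (c : 𝓞 K)).add
    (dvd_mul_right 13 (d * (η : 𝓞 K)))
  convert key using 1
  push_cast
  linear_combination -(η : 𝓞 K) * hcd'

theorem false_of_pow_add_pow_eq (hζ : IsPrimitiveRoot ζ 13) (k : ℕ) {x y w : 𝓞 K} {ε : (𝓞 K)ˣ}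
    (hxy : IsCoprime x y) (hy : ¬ hζ.toInteger - 1 ∣ y) (hw : ¬ hζ.toInteger - 1 ∣ w)
    (h : x ^ 13 + y ^ 13 = ε * (hζ.toInteger - 1) ^ (13 * (k + 1)) * w ^ 13) : False := by
  induction k using Nat.strong_induction_on generalizing x y w ε with
  | _ k ih =>
    have hz := hζ.toInteger_isPrimitiveRoot
    have hz_unit (i : ℕ) : IsUnit (hζ.toInteger ^ i) := (hz.isUnit (by norm_num)).pow i
    obtain ⟨i, hi⟩ := exists_sq_dvd_add_pow_mul hζ (x := x) hy
      (h ▸ ((dvd_pow_self _ (by lia)).mul_left _).mul_right _)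
    obtain ⟨hk, w₀, w₁, w₂, η, η', hcop, hw₂, hw₀, heq⟩ := exists_descent hζ (k := k) (ε := ε)
      ((isCoprime_mul_unit_left_right (hz_unit i) x y).mpr hxy)
      (by rwa [(hz_unit i).dvd_mul_left]) hw hi
      (by rw [← h, mul_pow, ← pow_mul, mul_comm i, pow_mul, hz.pow_eq_one, one_pow, one_mul])
    obtain ⟨m, rfl⟩ := Nat.exists_eq_succ_of_ne_zero hk
    have h13 : (13 : 𝓞 K) ∣ (hζ.toInteger - 1) ^ (13 * (m + 1)) := by
      have h := (IsCyclotomicExtension.Rat.associated_zeta_sub_one_pow_prime 13 hζ).symm.dvd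
      exact_mod_cast h.trans (pow_dvd_pow _ (by lia))
    obtain ⟨v, rfl⟩ := exists_eq_pow_thirteen_of_dvd_add hζ hw₂
      (heq ▸ (h13.mul_left _).mul_right _)
    refine ih m (by lia) (x := w₁) (y := v * w₂) (w := w₀) (ε := η')
      ((isCoprime_mul_unit_left_right v.isUnit _ _).mpr hcop) ?_ hw₀ ?_
    · rwa [v.isUnit.dvd_mul_left]
    · rw [← heq, mul_pow, Units.val_pow_eq_pow_val]

theorem fermat_thirteen_second_case (hζ : IsPrimitiveRoot ζ 13) {x y z : ℤ}
    (h : x ^ 13 + y ^ 13 = z ^ 13) (hxy : IsCoprime x y) (hy : ¬ (13 : ℤ) ∣ y)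
    (hz : (13 : ℤ) ∣ z) : z = 0 := by
  by_contra hz0
  have hdvd_iff (n : ℤ) := IsCyclotomicExtension.Rat.zeta_sub_one_dvd_intCast_iff' 13 hζ (n := n)
  obtain ⟨w, hzw, hw⟩ := (Int.finiteMultiplicity_iff.mpr
    ⟨by norm_num, hz0⟩ : FiniteMultiplicity 13 z).exists_eq_pow_mul_and_not_dvd
  obtain ⟨m, hm⟩ : ∃ m, multiplicity 13 z = m + 1 := by
    refine Nat.exists_eq_succ_of_ne_zero fun h0 ↦ hw ?_
    rwa [hzw, h0, pow_zero, one_mul] at hz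
  obtain ⟨u, hu⟩ := IsCyclotomicExtension.Rat.associated_zeta_sub_one_pow_prime 13 hζ
  refine false_of_pow_add_pow_eq hζ (12 * m + 11) (x := x) (y := y) (w := w)
    (ε := u ^ (13 * (m + 1))) (by exact_mod_cast hxy.map (Int.castRingHom (𝓞 K)))
    (by rwa [hdvd_iff]) (by rwa [hdvd_iff]) ?_
  have hcast := congrArg (Int.cast (R := 𝓞 K)) h
  rw [hzw, hm] at hcast
  push_cast at hcast hu
  rw [hcast, ← hu]
  push_cast
  generalize hζ.toInteger - 1 = l
  rw [mul_pow, mul_pow, mul_pow, ← pow_mul, ← pow_mul, ← pow_mul, mul_comm (l ^ _),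
    mul_comm (m + 1), show 12 * (13 * (m + 1)) = 13 * (12 * m + 11 + 1) by lia]

end CyclotomicThirteen

theorem isCoprime_of_pow_add_pow_eq {x y z : ℤ} (h : x ^ 13 + y ^ 13 = z ^ 13)
    (hgcd : ∀ p : ℤ, Prime p → p ∣ x → p ∣ y → ¬ p ∣ z) (hx : x ≠ 0) : IsCoprime x y := by
  refine isCoprime_of_prime_dvd (fun h0 ↦ hx h0.1) fun p hp hpx hpy ↦ hgcd p hp hpx hpy ?_
  exact hp.dvd_of_dvd_pow (h ▸ (dvd_pow hpx (by norm_num)).add (dvd_pow hpy (by norm_num)))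

/-- Fermat's Last Theorem for exponent 13: if `a^13 + b^13 = c^13` with
`gcd(a, b, c) = 1`, then `abc = 0`. -/
theorem fermat_thirteen
    (a b c : ℤ) (h : a ^ 13 + b ^ 13 = c ^ 13)
    (hgcd : Int.gcd (Int.gcd a b) c = 1) :
    a * b * c = 0 := by
  by_contra habc
  obtain ⟨⟨ha, hb⟩, hc⟩ : (a ≠ 0 ∧ b ≠ 0) ∧ c ≠ 0 := by simpa [not_or] using habc
  have hprime (p : ℤ) (hp : Prime p) (hpa : p ∣ a) (hpb : p ∣ b) : ¬ p ∣ c := fun hpc ↦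
    hp.not_isUnit (isUnit_of_dvd_one (by
      exact_mod_cast hgcd ▸ Int.dvd_coe_gcd (Int.dvd_coe_gcd hpa hpb) hpc))
  have hodd : Odd 13 := by decide
  have hbc : b ^ 13 + (-c) ^ 13 = (-a) ^ 13 := by
    rw [hodd.neg_pow, hodd.neg_pow]
    linear_combination h
  have hca : (-c) ^ 13 + a ^ 13 = (-b) ^ 13 := by
    rw [hodd.neg_pow, hodd.neg_pow]
    linear_combination h
  have hcop_ab : IsCoprime a b := isCoprime_of_pow_add_pow_eq h hprime ha
  have hcop_bc : IsCoprime b (-c) := isCoprime_of_pow_add_pow_eq hbc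
    (fun p hp hpb hpc hpa ↦ hprime p hp (by simpa using hpa) hpb (by simpa using hpc)) hb
  have hcop_ca : IsCoprime (-c) a := isCoprime_of_pow_add_pow_eq hca
    (fun p hp hpc hpa hpb ↦ hprime p hp hpa (by simpa using hpb) (by simpa using hpc))
    (neg_ne_zero.mpr hc)
  have h13 : Prime (13 : ℤ) := Int.prime_iff_natAbs_prime.mpr (by norm_num)
  have hnot {x y : ℤ} (hxy : IsCoprime x y) (hx : 13 ∣ x) : ¬ (13 : ℤ) ∣ y := fun hy ↦
    h13.not_isUnit (hxy.isUnit_of_dvd' hx hy)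
  have : IsCyclotomicExtension {13} ℚ (CyclotomicField 13 ℚ) :=
    CyclotomicField.isCyclotomicExtension 13 ℚ
  have : NumberField (CyclotomicField 13 ℚ) := IsCyclotomicExtension.numberField {13} ℚ _
  have hζ := IsCyclotomicExtension.zeta_spec 13 ℚ (CyclotomicField 13 ℚ)
  by_cases h13c : (13 : ℤ) ∣ c
  · exact hc (fermat_thirteen_second_case hζ h hcop_ab
      (hnot hcop_bc.symm ((dvd_neg).mpr h13c)) h13c)
  by_cases h13a : (13 : ℤ) ∣ a
  · exact neg_ne_zero.mpr ha (fermat_thirteen_second_case hζ hbc hcop_bc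
      (by rwa [dvd_neg]) (by rwa [dvd_neg]))
  by_cases h13b : (13 : ℤ) ∣ b
  · exact neg_ne_zero.mpr hb (fermat_thirteen_second_case hζ hca hcop_ca h13a (by rwa [dvd_neg]))
  exact fermat_thirteen_first_case (x := a) (y := b) (z := -c)
    (by rw [hodd.neg_pow]; linear_combination h) hcop_ab hcop_bc hcop_ca.symm h13a h13b
    (by rwa [dvd_neg])
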